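/- Canonical run existence: For every δ ∈ Δ(Σ), every F ⊆ E, and every maximal consistent set M ⊆ Φ(Σ), there is a run r = ⟨X^e, {f^e_u}_{u∈Inc(e)}⟩_{e∈E} of the canonical protocol 𝒫^δ_F such that X^e = M ∩ Φ(Σ,{e}) for each e ∈ E. -/

import Mathlib

/- Formulas of the language Φ(Σ): atoms are indexed by a type `P` of
propositional symbols; `edgeOf p` is the unique edge `e` with `p ∈ P_e`
(this encodes a pairwise disjoint family `{P_e}_{e ∈ E}`). -/
inductive Form (E P : Type) : Type
  | bot : Form E P
  | atom : P → Form E P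
  | imp : Form E P → Form E P → Form E P
  | box : E → Form E P → Form E P

namespace Form
/-- ¬φ abbreviates φ → ⊥. -/
def neg {E P : Type} (φ : Form E P) : Form E P := imp φ bot
/-- φ ∨ ψ abbreviates ¬φ → ψ. -/
def or {E P : Type} (φ ψ : Form E P) : Form E P := imp (neg φ) ψ
end Form

/-- An undirected multigraph is given by `inc : E → V × V` sending each edge to
its (two, possibly equal) ends.  `Incident inc e v` says `v` is an end of `e`. -/
def Incident {V E : Type} (inc : E → V × V) (e : E) (v : V) : Prop :=
  (inc e).1 = v ∨ (inc e).2 = v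

/-- Adjacency using only edges from the set `S`. -/
def AdjVia {V E : Type} (inc : E → V × V) (S : Set E) (u v : V) : Prop :=
  ∃ e ∈ S, inc e = (u, v) ∨ inc e = (v, u)

/-- Reachability using only edges from the set `S`. -/
def ReachableVia {V E : Type} (inc : E → V × V) (S : Set E) : V → V → Prop :=
  Relation.ReflTransGen (AdjVia inc S)

/-- The graph is connected. -/
def ConnectedGraph {V E : Type} (inc : E → V × V) : Prop :=
  ∀ u v : V, ReachableVia inc Set.univ u v

/-- A path `e₀, v₁, e₁, …, v_k, e_k`: distinct edges, distinct vertices, with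
`e_i, e_{i+1}` incident to `v_{i+1}` for `0 ≤ i < k`. -/
structure GPath (V E : Type) (inc : E → V × V) where
  edges : List E
  verts : List V
  len_eq : edges.length = verts.length + 1
  edges_nodup : edges.Nodup
  verts_nodup : verts.Nodup
  incid_left : ∀ i (hi : i < verts.length),
    Incident inc (edges.get ⟨i, by omega⟩) (verts.get ⟨i, hi⟩)
  incid_right : ∀ i (hi : i < verts.length),
    Incident inc (edges.get ⟨i + 1, by omega⟩) (verts.get ⟨i, hi⟩)

/-- `g` is a gateway between `A` and `B`: every path that starts with an edge
in `A` and ends with an edge in `B` contains the edge `g`. -/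
def IsGateway {V E : Type} (inc : E → V × V) (A B : Set E) (g : E) : Prop :=
  ∀ p : GPath V E inc, ∀ hne : p.edges ≠ [],
    p.edges.head hne ∈ A → p.edges.getLast hne ∈ B → g ∈ p.edges

/-- The sublanguage Φ(Σ,T). -/
inductive InLang {E P : Type} (edgeOf : P → E) (T : Set E) : Form E P → Prop
  | bot : InLang edgeOf T Form.bot
  | atom (p : P) : edgeOf p ∈ T → InLang edgeOf T (Form.atom p)
  | imp {φ ψ : Form E P} : InLang edgeOf T φ → InLang edgeOf T ψ →
      InLang edgeOf T (Form.imp φ ψ)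
  | box (t : E) (φ : Form E P) : t ∈ T → InLang edgeOf T (Form.box t φ)

/-- Evaluation of a formula under a truth assignment `v` that treats atoms and
boxed formulas as atomic. -/
def evalWith {E P : Type} (v : Form E P → Prop) : Form E P → Prop
  | Form.bot => False
  | Form.imp φ ψ => evalWith v φ → evalWith v ψ
  | φ => v φ

/-- Propositional tautology. -/
def Tautology {E P : Type} (φ : Form E P) : Prop := ∀ v, evalWith v φ

/-- The proof system: propositional tautologies, Truth, Positive Introspection,
Negative Introspection, Distributivity, Gateway; Modus Ponens, Necessitation. -/
inductive Deriv {V E P : Type} (inc : E → V × V) (edgeOf : P → E) : Form E P → Prop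
  | taut {φ : Form E P} : Tautology φ → Deriv inc edgeOf φ
  | truth (e : E) (φ : Form E P) : Deriv inc edgeOf (Form.imp (Form.box e φ) φ)
  | posIntro (e : E) (φ : Form E P) :
      Deriv inc edgeOf (Form.imp (Form.box e φ) (Form.box e (Form.box e φ)))
  | negIntro (e : E) (φ : Form E P) :
      Deriv inc edgeOf (Form.imp (Form.neg (Form.box e φ)) (Form.box e (Form.neg (Form.box e φ))))
  | distrib (e : E) (φ ψ : Form E P) :
      Deriv inc edgeOf (Form.imp (Form.box e (Form.imp φ ψ))
        (Form.imp (Form.box e φ) (Form.box e ψ)))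
  | gateway {A B : Set E} {g e : E} {φ ψ : Form E P} :
      IsGateway inc A B g → e ∈ A → InLang edgeOf A φ → InLang edgeOf B ψ →
      Deriv inc edgeOf (Form.imp (Form.box e (Form.imp φ ψ)) (Form.imp φ (Form.box g ψ)))
  | mp {φ ψ : Form E P} : Deriv inc edgeOf (Form.imp φ ψ) → Deriv inc edgeOf φ →
      Deriv inc edgeOf ψ
  | nec (e : E) {φ : Form E P} : Deriv inc edgeOf φ → Deriv inc edgeOf (Form.box e φ)

/-- `X ⊢ φ`: derivable from assumptions `X` using theorems of the system and
Modus Ponens only. -/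
inductive DerivFrom {V E P : Type} (inc : E → V × V) (edgeOf : P → E)
    (X : Set (Form E P)) : Form E P → Prop
  | ax {φ : Form E P} : Deriv inc edgeOf φ → DerivFrom inc edgeOf X φ
  | hyp {φ : Form E P} : φ ∈ X → DerivFrom inc edgeOf X φ
  | mp {φ ψ : Form E P} : DerivFrom inc edgeOf X (Form.imp φ ψ) →
      DerivFrom inc edgeOf X φ → DerivFrom inc edgeOf X ψ

/-- A protocol over the signature: a set of values `W e` for each channel `e`,
local conditions `L v` at each vertex, and a valuation `π`. -/
structure Protocol {V E P : Type} (inc : E → V × V) (edgeOf : P → E) where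
  W : E → Type
  L : (v : V) → Set ((e : {e : E // Incident inc e v}) → W e.1)
  pi : (p : P) → Set (W (edgeOf p))

/-- A run of a protocol. -/
def IsRun {V E P : Type} {inc : E → V × V} {edgeOf : P → E}
    (Pr : Protocol inc edgeOf) (r : (e : E) → Pr.W e) : Prop :=
  ∀ v : V, (fun e : {e : E // Incident inc e v} => r e.1) ∈ Pr.L v

def Run {V E P : Type} {inc : E → V × V} {edgeOf : P → E}
    (Pr : Protocol inc edgeOf) : Type :=
  {r : (e : E) → Pr.W e // IsRun Pr r}

/-- Satisfaction `r ⊩ φ`. -/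
def Sat {V E P : Type} {inc : E → V × V} {edgeOf : P → E}
    (Pr : Protocol inc edgeOf) : Run Pr → Form E P → Prop
  | _, Form.bot => False
  | r, Form.atom p => r.1 (edgeOf p) ∈ Pr.pi p
  | r, Form.imp φ ψ => Sat Pr r φ → Sat Pr r ψ
  | r, Form.box e φ => ∀ r' : Run Pr, r'.1 e = r.1 e → Sat Pr r' φ
/-- Big disjunction of a list of formulas. -/
def bigDisj {E P : Type} : List (Form E P) → Form E P
  | [] => Form.bot
  | φ :: l => Form.or φ (bigDisj l)

/-- The disjunction ⋁_{e ∈ s} δ_e. -/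
noncomputable def disjOver {E P : Type} (s : Finset E) (d : E → Form E P) : Form E P :=
  bigDisj (s.toList.map d)

/-- The formula δ = ⋁_{e ∈ E} δ_e. -/
noncomputable def deltaForm {E P : Type} [Fintype E] (d : E → Form E P) : Form E P :=
  disjOver Finset.univ d

/-- ⋁_{h ∈ S} δ_h for a set of edges `S`. -/
noncomputable def disjSet {E P : Type} [Fintype E] (d : E → Form E P) (S : Set E) : Form E P :=
  disjOver (Set.toFinite S).toFinset d

/-- `e` is a bridge: removing it disconnects the graph. -/
def IsBridge {V E : Type} (inc : E → V × V) (e : E) : Prop :=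
  ¬ ∀ u v : V, ReachableVia inc {x | x ≠ e} u v

/-- Edges of the connected component `C^u_{-e}` of the graph with `e` deleted
that contains the vertex `u`. -/
def compEdges {V E : Type} (inc : E → V × V) (e : E) (u : V) : Set E :=
  {h | h ≠ e ∧ ∃ w : V, Incident inc h w ∧ ReachableVia inc {x | x ≠ e} u w}

/-- `X` is consistent. -/
def ConsistentSet {V E P : Type} (inc : E → V × V) (edgeOf : P → E)
    (X : Set (Form E P)) : Prop :=
  ¬ DerivFrom inc edgeOf X Form.bot

/-- `X` is a maximal consistent subset of Φ(Σ,T). -/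
def MaxConsistentIn {V E P : Type} (inc : E → V × V) (edgeOf : P → E)
    (T : Set E) (X : Set (Form E P)) : Prop :=
  (∀ φ ∈ X, InLang edgeOf T φ) ∧ ConsistentSet inc edgeOf X ∧
    ∀ φ : Form E P, InLang edgeOf T φ → φ ∉ X →
      ¬ ConsistentSet inc edgeOf (insert φ X)

/-- `X` is a maximal consistent subset of Φ(Σ). -/
def MaxConsistent {V E P : Type} (inc : E → V × V) (edgeOf : P → E)
    (X : Set (Form E P)) : Prop :=
  ConsistentSet inc edgeOf X ∧
    ∀ φ : Form E P, φ ∉ X → ¬ ConsistentSet inc edgeOf (insert φ X)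

/-- A value of an edge under a canonical protocol 𝒫^δ_F: a set of formulas `X`
together with flow values `f₁`, `f₂` at the two ends `(inc e).1`, `(inc e).2`. -/
structure CanValue (E P : Type) where
  X : Set (Form E P)
  f₁ : ℝ
  f₂ : ℝ

/-- The defining conditions on a value of edge `e` under the canonical
protocol 𝒫^δ_F, where δ = ⋁_{e ∈ E} d e. -/
def IsCanValue {V E P : Type} [Fintype E] (inc : E → V × V) (edgeOf : P → E)
    (d : E → Form E P) (F : Set E) (e : E) (w : CanValue E P) : Prop :=
  MaxConsistentIn inc edgeOf {e} w.X ∧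
  (w.f₁ + w.f₂ > 0 ↔ d e ∈ w.X) ∧
  (IsBridge inc e → d e ∉ w.X → w.f₁ + w.f₂ = 0) ∧
  (IsBridge inc e → w.f₁ < 0 →
    Form.box e (disjSet d (compEdges inc e (inc e).1)) ∈ w.X) ∧
  (IsBridge inc e → w.f₂ < 0 →
    Form.box e (disjSet d (compEdges inc e (inc e).2)) ∈ w.X) ∧
  (IsBridge inc e → e ∈ F → Form.box e (deltaForm d) ∈ w.X → d e ∉ w.X →
    w.f₁ < 0 ∨ w.f₂ < 0) ∧
  (¬ IsBridge inc e → w.f₁ + w.f₂ < 0 → Form.box e (deltaForm d) ∈ w.X) ∧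
  (¬ IsBridge inc e → e ∈ F → Form.box e (deltaForm d) ∈ w.X → d e ∉ w.X →
    w.f₁ + w.f₂ < 0)

open Classical in
/-- The flow value `f^e_u` of edge `e` at vertex `u` (0 if `u` is not an end
of `e`; for a loop both ends contribute). -/
noncomputable def flowAt {V E P : Type} (inc : E → V × V) (w : CanValue E P)
    (e : E) (u : V) : ℝ :=
  (if (inc e).1 = u then w.f₁ else 0) + (if (inc e).2 = u then w.f₂ else 0)

/-- The local condition of the canonical protocol at a vertex `u`:
if δ_e ∉ X^e for every edge `e` incident to `u`, then Σ_{e ∈ Inc(u)} f^e_u ≥ 0. -/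
def CanLocal {V E P : Type} [Fintype E] (inc : E → V × V) (d : E → Form E P)
    (r : (e : E) → CanValue E P) (u : V) : Prop :=
  (∀ e : E, Incident inc e u → d e ∉ (r e).X) → 0 ≤ ∑ e : E, flowAt inc (r e) e u

/-- `r` is a run of the canonical protocol 𝒫^δ_F. -/
def IsCanRun {V E P : Type} [Fintype E] (inc : E → V × V) (edgeOf : P → E)
    (d : E → Form E P) (F : Set E) (r : (e : E) → CanValue E P) : Prop :=
  (∀ e : E, IsCanValue inc edgeOf d F e (r e)) ∧ ∀ u : V, CanLocal inc d r u

/-- The set Γ_M of paths (Definition of Γ_M). -/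
def InGamma {V E P : Type} [Fintype E] (inc : E → V × V) (d : E → Form E P)
    (M : Set (Form E P)) (p : GPath V E inc) : Prop :=
  0 < p.verts.length ∧
  (∀ h0 : 0 < p.verts.length,
    Form.box (p.edges.get ⟨0, by have := p.len_eq; omega⟩)
      (disjSet d (compEdges inc (p.edges.get ⟨0, by have := p.len_eq; omega⟩)
        (p.verts.get ⟨0, h0⟩))) ∈ M) ∧
  (∀ i (hi : i < p.verts.length),
    d (p.edges.get ⟨i, by have := p.len_eq; omega⟩) ∉ M) ∧
  (∀ i (hi : i < p.verts.length),
    IsBridge inc (p.edges.get ⟨i, by have := p.len_eq; omega⟩) →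
    Form.box (p.edges.get ⟨i, by have := p.len_eq; omega⟩)
      (disjSet d (compEdges inc (p.edges.get ⟨i, by have := p.len_eq; omega⟩)
        (p.verts.get ⟨i, hi⟩))) ∈ M) ∧
  (∀ hne : p.edges ≠ [], d (p.edges.getLast hne) ∈ M)

section Propositional

variable {V E P : Type} {inc : E → V × V} {edgeOf : P → E}

lemma evalWith_neg (v : Form E P → Prop) (φ : Form E P) :
    evalWith v (Form.neg φ) ↔ ¬ evalWith v φ := Iff.rfl

lemma evalWith_imp (v : Form E P → Prop) (φ ψ : Form E P) :
    evalWith v (Form.imp φ ψ) ↔ (evalWith v φ → evalWith v ψ) := Iff.rfl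

lemma evalWith_or (v : Form E P → Prop) (φ ψ : Form E P) :
    evalWith v (Form.or φ ψ) ↔ evalWith v φ ∨ evalWith v ψ :=
  or_iff_not_imp_left.symm

lemma evalWith_bigDisj (v : Form E P → Prop) (l : List (Form E P)) :
    evalWith v (bigDisj l) ↔ ∃ φ ∈ l, evalWith v φ := by
  induction l with
  | nil => simp [bigDisj, evalWith]
  | cons a l ih => rw [bigDisj, evalWith_or, ih, List.exists_mem_cons_iff]

lemma evalWith_deltaForm [Fintype E] (v : Form E P → Prop) (d : E → Form E P) :
    evalWith v (deltaForm d) ↔ ∃ h, evalWith v (d h) := by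
  rw [deltaForm, disjOver, evalWith_bigDisj]
  simp only [List.mem_map, Finset.mem_toList, Finset.mem_univ, true_and, exists_exists_eq_and]

lemma evalWith_disjSet [Fintype E] (v : Form E P → Prop) (d : E → Form E P) (S : Set E) :
    evalWith v (disjSet d S) ↔ ∃ h ∈ S, evalWith v (d h) := by
  rw [disjSet, disjOver, evalWith_bigDisj]
  simp only [List.mem_map, Finset.mem_toList, Set.Finite.mem_toFinset, exists_exists_and_eq_and]

lemma InLang.neg {T : Set E} {φ : Form E P} (h : InLang edgeOf T φ) :
    InLang edgeOf T (Form.neg φ) := .imp h .bot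

lemma InLang.or {T : Set E} {φ ψ : Form E P} (h : InLang edgeOf T φ)
    (h' : InLang edgeOf T ψ) : InLang edgeOf T (Form.or φ ψ) := .imp h.neg h'

lemma InLang.mono {S T : Set E} (hST : S ⊆ T) {φ : Form E P} (h : InLang edgeOf S φ) :
    InLang edgeOf T φ := by
  induction h with
  | bot => exact .bot
  | atom p hp => exact .atom p (hST hp)
  | imp _ _ ih ih' => exact .imp ih ih'
  | box t φ ht => exact .box t φ (hST ht)

lemma InLang.bigDisj {T : Set E} {l : List (Form E P)} (h : ∀ φ ∈ l, InLang edgeOf T φ) :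
    InLang edgeOf T (bigDisj l) := by
  induction l with
  | nil => exact .bot
  | cons a l ih =>
    exact .or (h a (by simp)) (ih fun φ hφ => h φ (by simp [hφ]))

lemma InLang.disjSet [Fintype E] {d : E → Form E P} (hd : ∀ e, InLang edgeOf {e} (d e))
    {S T : Set E} (hST : S ⊆ T) : InLang edgeOf T (disjSet d S) := by
  refine InLang.bigDisj fun φ hφ => ?_
  simp only [List.mem_map, Finset.mem_toList, Set.Finite.mem_toFinset] at hφ
  obtain ⟨h, hh, rfl⟩ := hφ
  exact (hd h).mono (by simpa using hST hh)

lemma Deriv.imp_trans {φ ψ χ : Form E P} (h : Deriv inc edgeOf (φ.imp ψ))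
    (h' : Deriv inc edgeOf (ψ.imp χ)) : Deriv inc edgeOf (φ.imp χ) := by
  refine .mp (.mp (.taut ?_) h) h'
  intro v
  simp only [evalWith_imp]
  tauto

lemma Deriv.box_mono (e : E) {φ ψ : Form E P} (h : Deriv inc edgeOf (φ.imp ψ)) :
    Deriv inc edgeOf ((Form.box e φ).imp (Form.box e ψ)) :=
  .mp (.distrib e φ ψ) (.nec e h)

lemma Deriv.box_gateway {B : Set E} {g e : E} {φ ψ : Form E P} (hg : IsGateway inc Bᶜ B g)
    (he : e ∉ B) (hφ : InLang edgeOf Bᶜ φ) (hψ : InLang edgeOf B ψ) :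
    Deriv inc edgeOf ((Form.box e (φ.imp ψ)).imp (Form.box e (φ.imp (Form.box g ψ)))) :=
  (Deriv.posIntro e _).imp_trans (Deriv.box_mono e (.gateway hg he hφ hψ))

lemma DerivFrom.mono {X Y : Set (Form E P)} (hXY : X ⊆ Y) {φ : Form E P}
    (h : DerivFrom inc edgeOf X φ) : DerivFrom inc edgeOf Y φ := by
  induction h with
  | ax h => exact .ax h
  | hyp h => exact .hyp (hXY h)
  | mp _ _ ih ih' => exact .mp ih ih'

lemma DerivFrom.deduction {X : Set (Form E P)} {φ ψ : Form E P}
    (h : DerivFrom inc edgeOf (insert φ X) ψ) : DerivFrom inc edgeOf X (φ.imp ψ) := by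
  have weaken : ∀ χ : Form E P, Deriv inc edgeOf (χ.imp (φ.imp χ)) := fun χ =>
    .taut fun v h _ => h
  induction h with
  | @ax χ h => exact .mp (.ax (weaken χ)) (.ax h)
  | @hyp χ h =>
    rcases h with rfl | h
    · exact .ax (.taut fun v h => h)
    · exact .mp (.ax (weaken χ)) (.hyp h)
  | @mp α β _ _ ih ih' =>
    refine .mp (.mp (.ax (.taut ?_)) ih) ih'
    intro v
    simp only [evalWith_imp]
    tauto

namespace MaxConsistent

variable {M : Set (Form E P)}

lemma mem_of_derivFrom (hM : MaxConsistent inc edgeOf M) {φ : Form E P}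
    (h : DerivFrom inc edgeOf M φ) : φ ∈ M := by
  by_contra hφ
  have := hM.2 φ hφ
  rw [ConsistentSet, not_not] at this
  exact hM.1 (.mp this.deduction h)

lemma mp_mem (hM : MaxConsistent inc edgeOf M) {φ ψ : Form E P}
    (h : Deriv inc edgeOf (φ.imp ψ)) (hφ : φ ∈ M) : ψ ∈ M :=
  hM.mem_of_derivFrom (.mp (.ax h) (.hyp hφ))

lemma bot_notMem (hM : MaxConsistent inc edgeOf M) : Form.bot ∉ M :=
  fun h => hM.1 (.hyp h)

lemma neg_mem (hM : MaxConsistent inc edgeOf M) {φ : Form E P} (hφ : φ ∉ M) :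
    Form.neg φ ∈ M := by
  have := hM.2 φ hφ
  rw [ConsistentSet, not_not] at this
  exact hM.mem_of_derivFrom this.deduction

lemma imp_mem_iff (hM : MaxConsistent inc edgeOf M) {φ ψ : Form E P} :
    φ.imp ψ ∈ M ↔ (φ ∈ M → ψ ∈ M) := by
  constructor
  · exact fun h hφ => hM.mem_of_derivFrom (.mp (.hyp h) (.hyp hφ))
  · intro h
    by_cases hφ : φ ∈ M
    · exact hM.mp_mem (.taut fun v a _ => a) (h hφ)
    · refine hM.mp_mem (.taut ?_) (hM.neg_mem hφ)
      intro v
      simp only [evalWith_imp, evalWith_neg]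
      tauto

lemma neg_mem_iff (hM : MaxConsistent inc edgeOf M) {φ : Form E P} :
    Form.neg φ ∈ M ↔ φ ∉ M := by
  rw [Form.neg, hM.imp_mem_iff]
  have := hM.bot_notMem
  tauto

lemma evalWith_mem_iff (hM : MaxConsistent inc edgeOf M) (φ : Form E P) :
    evalWith (· ∈ M) φ ↔ φ ∈ M := by
  induction φ with
  | bot => simpa [evalWith] using hM.bot_notMem
  | atom p => rfl
  | imp φ ψ ih ih' => rw [evalWith_imp, ih, ih', hM.imp_mem_iff]
  | box e φ => rfl

lemma or_mem_iff (hM : MaxConsistent inc edgeOf M) {φ ψ : Form E P} :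
    Form.or φ ψ ∈ M ↔ φ ∈ M ∨ ψ ∈ M := by
  rw [← hM.evalWith_mem_iff, evalWith_or, hM.evalWith_mem_iff, hM.evalWith_mem_iff]

lemma disjSet_mem_iff [Fintype E] (hM : MaxConsistent inc edgeOf M) {d : E → Form E P}
    {S : Set E} : disjSet d S ∈ M ↔ ∃ h ∈ S, d h ∈ M := by
  rw [← hM.evalWith_mem_iff, evalWith_disjSet]
  simp only [hM.evalWith_mem_iff]

lemma inter_inLang (hM : MaxConsistent inc edgeOf M) (T : Set E) :
    MaxConsistentIn inc edgeOf T (M ∩ {φ | InLang edgeOf T φ}) := by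
  refine ⟨fun φ h => h.2, fun h => hM.1 (h.mono Set.inter_subset_left), ?_⟩
  intro φ hφ hmem
  rw [ConsistentSet, not_not]
  have hneg : Form.neg φ ∈ M := hM.neg_mem fun h => hmem ⟨h, hφ⟩
  exact .mp (.hyp (Or.inr ⟨hneg, hφ.neg⟩)) (.hyp (Or.inl rfl))

end MaxConsistent

end Propositional

section Graph

variable {V E : Type} {inc : E → V × V}

lemma AdjVia.symm {S : Set E} {u v : V} (h : AdjVia inc S u v) : AdjVia inc S v u := by
  obtain ⟨e, he, h⟩ := h
  exact ⟨e, he, h.symm⟩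

lemma ReachableVia.symm {S : Set E} {u v : V} (h : ReachableVia inc S u v) :
    ReachableVia inc S v u := by
  induction h with
  | refl => exact .refl
  | tail _ hbc ih => exact .head hbc.symm ih

lemma ReachableVia.of_incident {S : Set E} {e : E} (he : e ∈ S) {u v : V}
    (hu : Incident inc e u) (hv : Incident inc e v) : ReachableVia inc S u v := by
  rcases hu with rfl | rfl <;> rcases hv with rfl | rfl
  · exact .refl
  · exact .single ⟨e, he, Or.inl rfl⟩
  · exact .single ⟨e, he, Or.inr rfl⟩
  · exact .refl

lemma incident_of_inc_eq {e : E} {u v : V} (h : inc e = (u, v) ∨ inc e = (v, u)) :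
    Incident inc e u ∧ Incident inc e v := by
  rcases h with h | h <;> simp [Incident, h]

lemma reachableVia_of_mem_compEdges {g h : E} {v x : V} (hh : h ∈ compEdges inc g v)
    (hx : Incident inc h x) : ReachableVia inc {x | x ≠ g} v x := by
  obtain ⟨hne, w, hw, hr⟩ := hh
  exact hr.trans (ReachableVia.of_incident hne hw hx)

lemma isGateway_compEdges (g : E) (v : V) :
    IsGateway inc (compEdges inc g v)ᶜ (compEdges inc g v) g := by
  intro p hne hhead hlast
  by_contra hg
  have hback : ∀ i (hi : i < p.edges.length), p.edges[i] ∈ compEdges inc g v →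
      p.edges[0]'(by omega) ∈ compEdges inc g v := by
    intro i
    induction i with
    | zero => exact fun _ h => h
    | succ i ih =>
      intro hi h
      have hlen := p.len_eq
      refine ih (by omega) ⟨?_, p.verts[i]'(by omega), p.incid_left i (by omega), ?_⟩
      · intro heq
        exact hg (heq ▸ List.getElem_mem _)
      · exact reachableVia_of_mem_compEdges h (p.incid_right i (by omega))
  apply hhead
  rw [List.head_eq_getElem]
  rw [List.getLast_eq_getElem] at hlast
  exact hback _ _ hlast

lemma not_isBridge_of_reachableVia (hconn : ConnectedGraph inc) {g : E}
    {u v : V} (hg : inc g = (u, v) ∨ inc g = (v, u))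
    (h : ReachableVia inc {x | x ≠ g} u v) : ¬ IsBridge inc g := by
  rw [IsBridge, not_not]
  intro a b
  induction hconn a b with
  | refl => exact .refl
  | @tail b c _ hbc ih =>
    refine ih.trans ?_
    obtain ⟨e, -, he⟩ := hbc
    by_cases heg : e = g
    · subst heg
      rcases hg with hg | hg <;> rcases he with he | he <;> rw [hg] at he <;>
        obtain ⟨rfl, rfl⟩ := Prod.mk.inj he <;> first | exact h | exact h.symm
    · exact .single ⟨e, heg, he⟩

lemma mem_compEdges_of_ne (hconn : ConnectedGraph inc) {e h : E} (hne : h ≠ e) :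
    h ∈ compEdges inc e (inc e).1 ∨ h ∈ compEdges inc e (inc e).2 := by
  have key : ∀ w, ReachableVia inc {x | x ≠ e} (inc e).1 w ∨
      ReachableVia inc {x | x ≠ e} (inc e).2 w := by
    intro w
    induction hconn (inc e).1 w with
    | refl => exact Or.inl .refl
    | @tail b c _ hbc ih =>
      obtain ⟨g, -, hg⟩ := hbc
      by_cases hge : g = e
      · subst hge
        rcases (incident_of_inc_eq hg).2 with rfl | rfl
        · exact Or.inl .refl
        · exact Or.inr .refl
      · exact ih.imp (fun h => h.tail ⟨g, hge, hg⟩) (fun h => h.tail ⟨g, hge, hg⟩)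
  exact (key (inc h).1).imp (fun hr => ⟨hne, _, Or.inl rfl, hr⟩)
    (fun hr => ⟨hne, _, Or.inl rfl, hr⟩)

/-- A vertex outside `S` is cut off from `S` by the last edge leaving `S` on the way to it. -/
lemma exists_crossing_of_reachableVia {S : Set V} {u w : V} (hu : u ∈ S)
    (h : ReachableVia inc Set.univ u w) (hw : w ∉ S) :
    ∃ g s v, s ∈ S ∧ v ∉ S ∧ (inc g = (s, v) ∨ inc g = (v, s)) ∧
      ReachableVia inc {x | x ≠ g} v w := by
  induction h with
  | refl => exact absurd hu hw
  | @tail b c _ hbc ih =>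
    obtain ⟨e, -, he⟩ := hbc
    by_cases hb : b ∈ S
    · exact ⟨e, b, c, hb, hw, he, .refl⟩
    · obtain ⟨g, s, v, hs, hv, hg, hr⟩ := ih hb
      refine ⟨g, s, v, hs, hv, hg, hr.tail ⟨e, ?_, he⟩⟩
      rintro rfl
      rcases hg with hg | hg <;> rcases he with he | he <;> rw [hg] at he <;>
        obtain ⟨rfl, rfl⟩ := Prod.mk.inj he <;> contradiction

end Graph

section Transport

variable {V E P : Type} [Fintype E] {inc : E → V × V} {edgeOf : P → E}
  {d : E → Form E P} {M : Set (Form E P)}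

open Classical in
/-- Distribution of knowledge over the far sides of several edges: if `e` knows that a
disjunct of `δ` holds on one of the far sides (or `σ` holds), and `σ` fails, then one of the
separating edges knows that a disjunct holds on its own far side. -/
lemma MaxConsistent.exists_box_compEdges_mem (hM : MaxConsistent inc edgeOf M)
    (hd : ∀ e, InLang edgeOf {e} (d e)) (e : E) (D : Finset (E × V))
    (he : ∀ p ∈ D, e ∉ compEdges inc p.1 p.2)
    (hD : ∀ p ∈ D, ∀ q ∈ D, p.1 ∉ compEdges inc q.1 q.2) (σ : Form E P) (T : Set E)
    (hσ : ∀ p ∈ D, InLang edgeOf (compEdges inc p.1 p.2)ᶜ σ)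
    (hT : ∀ h ∈ T, ∃ p ∈ D, h ∈ compEdges inc p.1 p.2) (hσM : σ ∉ M)
    (hbox : Form.box e ((Form.neg σ).imp (disjSet d T)) ∈ M) :
    ∃ p ∈ D, Form.box p.1 (disjSet d (compEdges inc p.1 p.2)) ∈ M := by
  induction D using Finset.induction_on generalizing σ T with
  | empty =>
    have h := hM.mp_mem (.truth e _) hbox
    rw [hM.imp_mem_iff, hM.neg_mem_iff, hM.disjSet_mem_iff] at h
    obtain ⟨x, hx, -⟩ := h hσM
    simpa using hT x hx
  | insert p D hp ih =>
    by_cases hpM : Form.box p.1 (disjSet d (compEdges inc p.1 p.2)) ∈ M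
    · exact ⟨p, Finset.mem_insert_self _ _, hpM⟩
    set B := compEdges inc p.1 p.2
    have hpmem := Finset.mem_insert_self p D
    have h1 : Form.box e ((Form.neg (Form.or σ (disjSet d (T \ B)))).imp (disjSet d B)) ∈ M := by
      refine hM.mp_mem (Deriv.box_mono e (.taut ?_)) hbox
      intro v
      simp only [evalWith_imp, evalWith_neg, evalWith_or, evalWith_disjSet]
      intro h h'
      push Not at h'
      obtain ⟨x, hx, hxv⟩ := h h'.1
      by_contra hcon
      exact h'.2 x ⟨hx, fun hxB => hcon ⟨x, hxB, hxv⟩⟩ hxv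
    have h2 := hM.mp_mem (Deriv.box_gateway (isGateway_compEdges p.1 p.2) (he p hpmem)
      ((hσ p hpmem).or (.disjSet hd fun x hx => hx.2)).neg (.disjSet hd subset_rfl)) h1
    have h3 : Form.box e ((Form.neg (Form.or σ (Form.box p.1 (disjSet d B)))).imp
        (disjSet d (T \ B))) ∈ M := by
      refine hM.mp_mem (Deriv.box_mono e (.taut ?_)) h2
      intro v
      simp only [evalWith_imp, evalWith_neg, evalWith_or]
      tauto
    obtain ⟨q, hq, hqM⟩ := ih (fun q hq => he q (Finset.mem_insert_of_mem hq))
      (fun q hq q' hq' => hD q (Finset.mem_insert_of_mem hq) q' (Finset.mem_insert_of_mem hq'))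
      _ _ (fun q hq => (hσ q (Finset.mem_insert_of_mem hq)).or
        (.box _ _ (hD p hpmem q (Finset.mem_insert_of_mem hq))))
      (fun h hh => by
        obtain ⟨q, hq, hhq⟩ := hT h hh.1
        rcases Finset.mem_insert.1 hq with rfl | hq
        · exact absurd hhq hh.2
        · exact ⟨q, hq, hhq⟩)
      (by rw [hM.or_mem_iff]; tauto) h3
    exact ⟨q, Finset.mem_insert_of_mem hq, hqM⟩

lemma MaxConsistent.exists_box_compEdges_mem_of_delta (hM : MaxConsistent inc edgeOf M)
    (hd : ∀ e, InLang edgeOf {e} (d e)) {e : E} (D : Finset (E × V))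
    (he : ∀ p ∈ D, e ∉ compEdges inc p.1 p.2)
    (hD : ∀ p ∈ D, ∀ q ∈ D, p.1 ∉ compEdges inc q.1 q.2)
    (hT : ∀ h, d h ∈ M → ∃ p ∈ D, h ∈ compEdges inc p.1 p.2)
    (hbox : Form.box e (deltaForm d) ∈ M) :
    ∃ p ∈ D, Form.box p.1 (disjSet d (compEdges inc p.1 p.2)) ∈ M := by
  set U : Set E := {h | ∃ p ∈ D, h ∈ compEdges inc p.1 p.2}
  refine hM.exists_box_compEdges_mem hd e D he hD (disjSet d Uᶜ) U ?_ (fun h hh => hh) ?_ ?_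
  · exact fun p hp => .disjSet hd fun x hx hxp => hx ⟨p, hp, hxp⟩
  · rw [hM.disjSet_mem_iff]
    rintro ⟨h, hh, hhM⟩
    exact hh (hT h hhM)
  · refine hM.mp_mem (Deriv.box_mono e (.taut ?_)) hbox
    intro v
    simp only [evalWith_imp, evalWith_neg, evalWith_disjSet, evalWith_deltaForm]
    rintro ⟨x, hx⟩ h
    by_contra hcon
    exact h ⟨x, fun hxU => hcon ⟨x, hxU, hx⟩, hx⟩

lemma MaxConsistent.box_compEdges_end_mem (hM : MaxConsistent inc edgeOf M)
    (hconn : ConnectedGraph inc) (hd : ∀ e, InLang edgeOf {e} (d e)) {e : E} (he : d e ∉ M)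
    (hbox : Form.box e (deltaForm d) ∈ M) :
    Form.box e (disjSet d (compEdges inc e (inc e).1)) ∈ M ∨
      Form.box e (disjSet d (compEdges inc e (inc e).2)) ∈ M := by
  classical
  have hself : ∀ v, e ∉ compEdges inc e v := fun v h => h.1 rfl
  obtain ⟨p, hp, h⟩ := hM.exists_box_compEdges_mem_of_delta hd (e := e)
    {(e, (inc e).1), (e, (inc e).2)} (by simp [hself]) (by simp [hself]) (by
      intro h hh
      have hne : h ≠ e := by rintro rfl; exact he hh
      simpa using mem_compEdges_of_ne hconn hne) hbox
  simp only [Finset.mem_insert, Finset.mem_singleton] at hp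
  rcases hp with rfl | rfl
  · exact Or.inl h
  · exact Or.inr h

/-- The edge `g` can carry a demand for flow from `x` to `y`. -/
def CarriesDemand (inc : E → V × V) (d : E → Form E P) (M : Set (Form E P))
    (g : E) (x y : V) : Prop :=
  d g ∉ M ∧ (inc g = (x, y) ∨ inc g = (y, x)) ∧
    (IsBridge inc g → Form.box g (disjSet d (compEdges inc g y)) ∈ M)

/-- The vertex `u` is incident to an edge whose disjunct of `δ` holds. -/
def IsSource (inc : E → V × V) (d : E → Form E P) (M : Set (Form E P)) (u : V) : Prop :=
  ∃ h, Incident inc h u ∧ d h ∈ M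

lemma MaxConsistent.exists_source_of_delta (hM : MaxConsistent inc edgeOf M)
    (hconn : ConnectedGraph inc) (hd : ∀ e, InLang edgeOf {e} (d e)) {e : E} {u : V}
    (hu : Incident inc e u) (hbox : Form.box e (deltaForm d) ∈ M) :
    ∃ w, IsSource inc d M w ∧
      Relation.ReflTransGen (fun x y => ∃ g, CarriesDemand inc d M g x y) u w := by
  by_contra hcon
  push Not at hcon
  set S : Set V :=
    {x | Relation.ReflTransGen (fun x y => ∃ g, CarriesDemand inc d M g x y) u x}
  have huS : u ∈ S := .refl
  have hsource : ∀ x ∈ S, ¬ IsSource inc d M x := fun x hx hs => hcon x hs hx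
  set D : Set (E × V) :=
    {p | p.2 ∉ S ∧ ∃ s ∈ S, inc p.1 = (s, p.2) ∨ inc p.1 = (p.2, s)}
  have hDfin : D.Finite := by
    refine ((Set.finite_range fun g => (g, (inc g).1)).union
      (Set.finite_range fun g => (g, (inc g).2))).subset ?_
    rintro ⟨g, v⟩ ⟨-, s, -, h | h⟩
    · exact Or.inr ⟨g, by simp_all⟩
    · exact Or.inl ⟨g, by simp_all⟩
  have hnot : ∀ p ∈ D, IsBridge inc p.1 ∧
      Form.box p.1 (disjSet d (compEdges inc p.1 p.2)) ∉ M := by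
    rintro ⟨g, v⟩ ⟨hv, s, hs, hg⟩
    by_contra h
    refine hv (Relation.ReflTransGen.tail hs ⟨g, ?_, hg, by tauto⟩)
    exact fun hgM => hsource s hs ⟨g, (incident_of_inc_eq hg).1, hgM⟩
  have hfar : ∀ p ∈ D, ∀ h x, x ∈ S → Incident inc h x → h ∉ compEdges inc p.1 p.2 := by
    rintro ⟨g, v⟩ hp h x hx hhx hmem
    obtain ⟨hv, s, hs, hg⟩ := id hp
    have hreach : ∀ y ∈ S, ReachableVia inc {x | x ≠ g} u y := by
      intro y hy
      change Relation.ReflTransGen _ u y at hy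
      induction hy with
      | refl => exact .refl
      | @tail b c hb hbc ih =>
        obtain ⟨k, hk⟩ := id hbc
        refine ih.tail ⟨k, ?_, hk.2.1⟩
        rintro rfl
        have hbS : b ∈ S := hb
        have hcS : c ∈ S := hb.tail hbc
        rcases (incident_of_inc_eq hg).2 with h1 | h1 <;> rcases hk.2.1 with h2 | h2 <;>
          rw [h2] at h1 <;> subst h1 <;> contradiction
    refine not_isBridge_of_reachableVia hconn hg ?_ (hnot _ hp).1
    exact (hreach s hs).symm.trans
      ((hreach x hx).trans (reachableVia_of_mem_compEdges hmem hhx).symm)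
  obtain ⟨p, hp, hpM⟩ := hM.exists_box_compEdges_mem_of_delta hd (e := e) hDfin.toFinset
    (fun p hp => hfar p (by simpa using hp) e u huS hu)
    (fun p hp q hq => by
      obtain ⟨-, s, hs, hg⟩ := hDfin.mem_toFinset.1 hp
      exact hfar q (by simpa using hq) p.1 s hs (incident_of_inc_eq hg).1)
    (by
      intro h hh
      have hw : (inc h).1 ∉ S := fun hS' => hsource _ hS' ⟨h, Or.inl rfl, hh⟩
      obtain ⟨g, s, v, hs, hv, hg, hr⟩ := exists_crossing_of_reachableVia huS (hconn u _) hw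
      refine ⟨(g, v), hDfin.mem_toFinset.2 ⟨hv, s, hs, hg⟩, ?_, _, Or.inl rfl, hr⟩
      rintro rfl
      exact hsource s hs ⟨h, (incident_of_inc_eq hg).1, hh⟩) hbox
  exact (hnot p (by simpa using hp)).2 hpM

end Transport

/-- A weight that decays geometrically with the distance to a target set. -/
lemma exists_geometric_potential {V : Type} (A : V → V → Prop) (H : V → Prop) {q : ℝ}
    (hq : 0 < q) (hq1 : q ≤ 1) :
    ∃ c : V → ℝ, (∀ v, 0 ≤ c v) ∧
      (∀ v w, H w → Relation.ReflTransGen A v w → 0 < c v) ∧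
      ∀ v, 0 < c v → ¬ H v → ∃ w, A v w ∧ c v ≤ q * c w := by
  classical
  let R : ℕ → V → Prop := Nat.rec (motive := fun _ => V → Prop) H fun _ Q v => ∃ w, A v w ∧ Q w
  have hpos : ∀ v (h : ∃ n, R n v), 0 < q ^ Nat.find h :=
    fun _ h => pow_pos hq (Nat.find h)
  refine ⟨fun v => if h : ∃ n, R n v then q ^ Nat.find h else 0, ?_, ?_, ?_⟩
  · intro v
    dsimp only
    split_ifs with h
    · exact (hpos v h).le
    · exact le_rfl
  · intro v w hw hvw
    have h : ∃ n, R n v := by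
      induction hvw using Relation.ReflTransGen.head_induction_on with
      | refl => exact ⟨0, hw⟩
      | head hab _ ih =>
        obtain ⟨n, hn⟩ := ih
        exact ⟨n + 1, _, hab, hn⟩
    simpa only [dif_pos h] using hpos v h
  · intro v hv hHv
    have h : ∃ n, R n v := by
      by_contra h
      simp [dif_neg h] at hv
    obtain ⟨k, hk⟩ : ∃ k, Nat.find h = k + 1 := by
      refine Nat.exists_eq_succ_of_ne_zero fun h0 => hHv ?_
      have := Nat.find_spec h
      rw [h0] at this
      exact this
    obtain ⟨w, hvw, hw⟩ : ∃ w, A v w ∧ R k w := by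
      have := Nat.find_spec h
      rw [hk] at this
      exact this
    have h' : ∃ n, R n w := ⟨k, hw⟩
    refine ⟨w, hvw, ?_⟩
    simp only [dif_pos h, dif_pos h', hk]
    rw [pow_succ']
    exact mul_le_mul_of_nonneg_left
      (pow_le_pow_of_le_one hq.le hq1 (Nat.find_min' h' hw)) hq.le

section EdgeFlow

variable {q c₁ c₂ : ℝ} {B N D P₁ P₂ R₁ R₂ : Prop}

/-- The conditions on the two flow values of an edge on which `δ` fails: `B` says that it is a
bridge, `N` that it must absorb flow, `D` that it may, `P₁` and `P₂` that a bridge may have a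
negative value at the respective end, and `R₁` and `R₂` that the respective end relies on it. -/
def EdgeFlow (q c₁ c₂ : ℝ) (B N D P₁ P₂ R₁ R₂ : Prop) (f₁ f₂ : ℝ) : Prop :=
  f₁ + f₂ ≤ 0 ∧ (B → f₁ + f₂ = 0) ∧ (B → f₁ < 0 → P₁) ∧ (B → f₂ < 0 → P₂) ∧
    (B → N → f₁ < 0 ∨ f₂ < 0) ∧ (¬ B → f₁ + f₂ < 0 → D) ∧ (¬ B → N → f₁ + f₂ < 0) ∧
    -(2 * q * c₁) ≤ f₁ ∧ -(2 * q * c₂) ≤ f₂ ∧ (R₁ → c₁ ≤ f₁) ∧ (R₂ → c₂ ≤ f₂)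

lemma EdgeFlow.swap {f₁ f₂ : ℝ} (h : EdgeFlow q c₂ c₁ B N D P₂ P₁ R₂ R₁ f₂ f₁) :
    EdgeFlow q c₁ c₂ B N D P₁ P₂ R₁ R₂ f₁ f₂ := by
  obtain ⟨h1, h2, h3, h4, h5, h6, h7, h8, h9, h10, h11⟩ := h
  rw [add_comm f₂ f₁] at h1 h2 h6 h7
  exact ⟨h1, h2, h4, h3, fun b n => (h5 b n).symm, h6, h7, h9, h8, h11, h10⟩

lemma exists_edgeFlow_of_relies_left (hq : 0 < q) (hq1 : q ≤ 1 / 4) (hND : N → D)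
    (hR₁ : R₁ → (B → P₂) ∧ 0 < c₁ ∧ c₁ ≤ q * c₂)
    (hR₂ : R₂ → (B → P₁) ∧ 0 < c₂ ∧ c₂ ≤ q * c₁) (h : R₁) :
    ∃ f₁ f₂, EdgeFlow q c₁ c₂ B N D P₁ P₂ R₁ R₂ f₁ f₂ := by
  classical
  obtain ⟨hP, hc, hle⟩ := hR₁ h
  have hnR₂ : ¬ R₂ := fun h' => by
    obtain ⟨-, hc', hle'⟩ := hR₂ h'
    nlinarith
  have hqc : 0 < q * c₁ := mul_pos hq hc
  by_cases hB : ¬ B ∧ N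
  · refine ⟨c₁, -(2 * c₁), by linarith, fun b => absurd b hB.1, fun b => absurd b hB.1,
      fun b => absurd b hB.1, fun b => absurd b hB.1, fun _ _ => hND hB.2, fun _ _ => by linarith,
      by linarith, by linarith, fun _ => le_rfl, fun h' => absurd h' hnR₂⟩
  · refine ⟨c₁, -c₁, by linarith, fun _ => by linarith, fun _ h' => by linarith,
      fun b _ => hP b, fun _ _ => Or.inr (by linarith), fun _ h' => by linarith,
      fun b n => absurd ⟨b, n⟩ hB, by linarith, by linarith, fun _ => le_rfl,
      fun h' => absurd h' hnR₂⟩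

lemma exists_edgeFlow (hq : 0 < q) (hq1 : q ≤ 1 / 4) (hc₁ : 0 ≤ c₁) (hc₂ : 0 ≤ c₂)
    (hND : N → D) (hN : N → 0 < c₁ ∧ 0 < c₂) (hNB : N → B → P₁ ∨ P₂)
    (hR₁ : R₁ → (B → P₂) ∧ 0 < c₁ ∧ c₁ ≤ q * c₂)
    (hR₂ : R₂ → (B → P₁) ∧ 0 < c₂ ∧ c₂ ≤ q * c₁) :
    ∃ f₁ f₂, EdgeFlow q c₁ c₂ B N D P₁ P₂ R₁ R₂ f₁ f₂ := by
  have hqc₁ : 0 ≤ q * c₁ := mul_nonneg hq.le hc₁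
  have hqc₂ : 0 ≤ q * c₂ := mul_nonneg hq.le hc₂
  by_cases h₁ : R₁
  · exact exists_edgeFlow_of_relies_left hq hq1 hND hR₁ hR₂ h₁
  by_cases h₂ : R₂
  · obtain ⟨f₂, f₁, h⟩ := exists_edgeFlow_of_relies_left (N := N) hq hq1 hND hR₂ hR₁ h₂
    exact ⟨f₁, f₂, h.swap⟩
  by_cases n : N
  · have hqc₁' : 0 < q * c₁ := mul_pos hq (hN n).1
    have hqc₂' : 0 < q * c₂ := mul_pos hq (hN n).2
    by_cases b : B
    · rcases hNB n b with hP | hP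
      · exact ⟨-(q * c₁), q * c₁, by linarith, fun _ => by linarith, fun _ _ => hP,
          fun _ h => by linarith, fun _ _ => Or.inl (by linarith), fun h => absurd b h,
          fun h => absurd b h, by linarith, by linarith, fun h => absurd h h₁,
          fun h => absurd h h₂⟩
      · exact ⟨q * c₂, -(q * c₂), by linarith, fun _ => by linarith, fun _ h => by linarith,
          fun _ _ => hP, fun _ _ => Or.inr (by linarith), fun h => absurd b h,
          fun h => absurd b h, by linarith, by linarith, fun h => absurd h h₁,
          fun h => absurd h h₂⟩
    · exact ⟨-(q * c₁), 0, by linarith, fun h => absurd h b, fun h => absurd h b,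
        fun h => absurd h b, fun h => absurd h b, fun _ _ => hND n, fun _ _ => by linarith,
        by linarith, by linarith, fun h => absurd h h₁, fun h => absurd h h₂⟩
  · exact ⟨0, 0, by simp, by simp, by simp, by simp, fun _ h => absurd h n, by simp,
      fun _ h => absurd h n, by linarith, by linarith, fun h => absurd h h₁,
      fun h => absurd h h₂⟩

end EdgeFlow

/-- Canonical run existence: for every δ ∈ Δ(Σ), every F ⊆ E,
and every maximal consistent set M ⊆ Φ(Σ), there is a run r of 𝒫^δ_F with
X^e = M ∩ Φ(Σ,{e}) for each edge e. -/
theorem canRun_exists {V E P : Type} [Fintype E] (inc : E → V × V) (edgeOf : P → E)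
    (hconn : ConnectedGraph inc)
    (d : E → Form E P) (hd : ∀ e : E, InLang edgeOf {e} (d e))
    (F : Set E)
    (M : Set (Form E P)) (hM : MaxConsistent inc edgeOf M) :
    ∃ r : (e : E) → CanValue E P, IsCanRun inc edgeOf d F r ∧
      ∀ e : E, (r e).X = M ∩ {φ | InLang edgeOf {e} φ} := by
  classical
  set m : ℝ := (Fintype.card E : ℝ) with hm
  have hm0 : 0 ≤ m := Nat.cast_nonneg _
  set q : ℝ := 1 / (4 * m + 4) with hqdef
  have hq : 0 < q := by positivity
  have hqm : q * (4 * m + 4) = 1 := by rw [hqdef]; field_simp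
  have hq1 : q ≤ 1 / 4 := by nlinarith
  obtain ⟨c, hc0, hcpos, hcnext⟩ := exists_geometric_potential
    (fun x y => ∃ g, CarriesDemand inc d M g x y) (IsSource inc d M) hq (by linarith)
  let Relies : E → V → Prop := fun e v =>
    0 < c v ∧ ∃ w, CarriesDemand inc d M e v w ∧ c v ≤ q * c w
  have hother : ∀ {e : E} {a b : V}, inc e = (a, b) ∨ inc e = (b, a) → Relies e a →
      (IsBridge inc e → Form.box e (disjSet d (compEdges inc e b)) ∈ M) ∧ 0 < c a ∧
        c a ≤ q * c b := by
    rintro e a b hab ⟨hpos, w, ⟨-, haw, hbox⟩, hle⟩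
    have hwa : w ≠ a := by
      rintro rfl
      nlinarith
    have hwb : w = b := by
      rcases hab with h | h <;> rcases haw with h' | h' <;> rw [h] at h' <;>
        obtain ⟨h1, h2⟩ := Prod.mk.inj h' <;> simp_all
    subst hwb
    exact ⟨hbox, hpos, hle⟩
  have hflow : ∀ e, ∃ f₁ f₂ : ℝ, (d e ∈ M → 0 < f₁ ∧ 0 < f₂) ∧
      (d e ∉ M → EdgeFlow q (c (inc e).1) (c (inc e).2) (IsBridge inc e)
        (e ∈ F ∧ Form.box e (deltaForm d) ∈ M) (Form.box e (deltaForm d) ∈ M)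
        (Form.box e (disjSet d (compEdges inc e (inc e).1)) ∈ M)
        (Form.box e (disjSet d (compEdges inc e (inc e).2)) ∈ M)
        (Relies e (inc e).1) (Relies e (inc e).2) f₁ f₂) := by
    intro e
    by_cases he : d e ∈ M
    · exact ⟨1, 1, fun _ => by simp, fun h => absurd he h⟩
    · have hpos : ∀ u, Incident inc e u → Form.box e (deltaForm d) ∈ M → 0 < c u := by
        intro u hu hbox
        obtain ⟨w, hw, huw⟩ := hM.exists_source_of_delta hconn hd hu hbox
        exact hcpos u w hw huw
      obtain ⟨f₁, f₂, h⟩ := exists_edgeFlow hq hq1 (hc0 (inc e).1) (hc0 (inc e).2)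
        (B := IsBridge inc e) (N := e ∈ F ∧ Form.box e (deltaForm d) ∈ M) And.right
        (fun h => ⟨hpos _ (Or.inl rfl) h.2, hpos _ (Or.inr rfl) h.2⟩)
        (fun h _ => hM.box_compEdges_end_mem hconn hd he h.2)
        (hother (e := e) (Or.inl rfl)) (hother (e := e) (Or.inr rfl))
      exact ⟨f₁, f₂, fun h => absurd h he, fun _ => h⟩
  choose f₁ f₂ hhot hcold using hflow
  have hmem : ∀ e, d e ∈ M ∩ {φ | InLang edgeOf {e} φ} ↔ d e ∈ M :=
    fun e => ⟨And.left, fun h => ⟨h, hd e⟩⟩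
  have hboxmem : ∀ e φ, Form.box e φ ∈ M ∩ {φ | InLang edgeOf {e} φ} ↔ Form.box e φ ∈ M :=
    fun e φ => ⟨And.left, fun h => ⟨h, .box e φ rfl⟩⟩
  refine ⟨fun e => ⟨M ∩ {φ | InLang edgeOf {e} φ}, f₁ e, f₂ e⟩, ⟨fun e => ?_, fun u => ?_⟩,
    fun e => rfl⟩
  · refine ⟨hM.inter_inLang {e}, ?_⟩
    simp only [hmem, hboxmem]
    by_cases he : d e ∈ M
    · obtain ⟨h1, h2⟩ := hhot e he
      exact ⟨⟨fun _ => he, fun _ => by linarith⟩, fun _ h => absurd he h, fun _ h => by linarith,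
        fun _ h => by linarith, fun _ _ _ h => absurd he h, fun _ h => by linarith,
        fun _ _ _ h => absurd he h⟩
    · obtain ⟨h1, h2, h3, h4, h5, h6, h7, -⟩ := hcold e he
      exact ⟨⟨fun h => by linarith, fun h => absurd h he⟩, fun b _ => h2 b, h3, h4,
        fun b hF hbox _ => h5 b ⟨hF, hbox⟩, h6, fun b hF hbox _ => h7 b ⟨hF, hbox⟩⟩
  · intro hu
    simp only [hmem] at hu
    have hbound : ∀ e,
        -(4 * q * c u) ≤ flowAt inc ⟨M ∩ {φ | InLang edgeOf {e} φ}, f₁ e, f₂ e⟩ e u ∧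
        (Incident inc e u → Relies e u →
          c u - 4 * q * c u ≤ flowAt inc ⟨M ∩ {φ | InLang edgeOf {e} φ}, f₁ e, f₂ e⟩ e u) := by
      intro e
      have hqc : 0 ≤ q * c u := mul_nonneg hq.le (hc0 u)
      have hcu := hc0 u
      simp only [flowAt]
      by_cases hinc : Incident inc e u
      · obtain ⟨-, -, -, -, -, -, -, h8, h9, h10, h11⟩ := hcold e (hu e hinc)
        split_ifs with ha hb hb
        · rw [ha] at h8 h10
          rw [hb] at h9 h11
          exact ⟨by linarith, fun _ h => by linarith [h10 h]⟩
        · rw [ha] at h8 h10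
          exact ⟨by linarith, fun _ h => by linarith [h10 h]⟩
        · rw [hb] at h9 h11
          exact ⟨by linarith, fun _ h => by linarith [h11 h]⟩
        · exact absurd hinc (not_or.2 ⟨ha, hb⟩)
      · rw [if_neg fun h => hinc (Or.inl h), if_neg fun h => hinc (Or.inr h)]
        exact ⟨by linarith, fun h => absurd h hinc⟩
    rcases (hc0 u).eq_or_lt with h0 | hpos
    · refine Finset.sum_nonneg fun e _ => ?_
      simpa [← h0] using (hbound e).1
    · obtain ⟨w, ⟨g, hg⟩, hle⟩ := hcnext u hpos fun ⟨h, hh, hhM⟩ => hu h hh hhM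
      have hg' := (hbound g).2 (incident_of_inc_eq hg.2.1).1 ⟨hpos, w, hg, hle⟩
      have hsum : ∑ e : E, ((if e = g then c u else 0) - 4 * q * c u) ≤
          ∑ e : E, flowAt inc ⟨M ∩ {φ | InLang edgeOf {e} φ}, f₁ e, f₂ e⟩ e u := by
        refine Finset.sum_le_sum fun e _ => ?_
        split_ifs with heg
        · rw [heg]
          exact hg'
        · linarith [(hbound e).1]
      refine le_trans ?_ hsum
      rw [Finset.sum_sub_distrib, Finset.sum_ite_eq' Finset.univ g, Finset.sum_const,
        Finset.card_univ, nsmul_eq_mul, ← hm]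
      simp only [Finset.mem_univ, if_true]
      have : m * (4 * q * c u) = c u * (q * (4 * m + 4)) - 4 * (q * c u) := by ring
      rw [this, hqm]
      nlinarith [mul_pos hq hpos]
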